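/- arXiv:1712.03764 — 4 statements merged into one kernel-verified Lean document; each statement's English description precedes it below -/
import Mathlib

section
/- Let G be a nonempty tree with n edges (n ≥ 1). Then the stringiness of G satisfies σ(G) ≥ n + 1. -/
open Classical in
/-- The stringiness of a graph: `(d₁ + 1) · ∏_{i ≥ 2} dᵢ` where `d₁ ≥ d₂ ≥ …` are
the vertex degrees in decreasing order. -/
noncomputable def stringiness {V : Type*} [Fintype V] (G : SimpleGraph V) : ℕ :=
  if h : ∃ v0 : V, ∀ v, G.degree v ≤ G.degree v0 then
    (G.degree h.choose + 1) * ∏ v ∈ Finset.univ.erase h.choose, G.degree v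
  else 1

/-- The Bernoulli-type inequality `1 + ∑ (f i - 1) ≤ ∏ f i` for positive naturals `f i`. -/
theorem Finset.sum_add_one_le_prod_add_card {ι : Type*} (s : Finset ι) (f : ι → ℕ)
    (hf : ∀ i ∈ s, 1 ≤ f i) : ∑ i ∈ s, f i + 1 ≤ ∏ i ∈ s, f i + s.card := by
  classical
  induction s using Finset.induction_on with
  | empty => simp
  | insert a s ha ih =>
    have hs : ∀ i ∈ s, 1 ≤ f i := fun i hi => hf i (Finset.mem_insert_of_mem hi)
    have h₁ : 1 ≤ f a := hf a (Finset.mem_insert_self a s)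
    have h₂ : 1 ≤ ∏ i ∈ s, f i := Nat.pos_of_ne_zero
      (Finset.prod_ne_zero_iff.mpr fun i hi => Nat.ne_of_gt (hs i hi))
    have h₃ := ih hs
    rw [Finset.sum_insert ha, Finset.prod_insert ha, Finset.card_insert_of_notMem ha]
    nlinarith [Nat.mul_le_mul h₁ h₂]

open Classical in
theorem stringiness_lower_bound {V : Type*} [Fintype V] (G : SimpleGraph V)
    (hG : G.IsTree) (n : ℕ) (hn : 1 ≤ n) (hedges : G.edgeFinset.card = n) :
    n + 1 ≤ stringiness G := by
  have hcard := hG.card_edgeFinset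
  have hsum := G.sum_degrees_eq_twice_card_edges
  have : Nontrivial V := Fintype.one_lt_card_iff_nontrivial.mp (by omega)
  have hpos (v : V) : 1 ≤ G.degree v := hG.connected.preconnected.degree_pos_of_nontrivial v
  have hmax : ∃ v₀ : V, ∀ v, G.degree v ≤ G.degree v₀ := Finite.exists_max fun v => G.degree v
  rw [stringiness, dif_pos hmax]
  generalize hmax.choose = v₀
  have hbound := Finset.sum_add_one_le_prod_add_card (Finset.univ.erase v₀)
    (fun v => G.degree v) fun v _ => hpos v
  have hprod : 1 ≤ ∏ v ∈ Finset.univ.erase v₀, G.degree v :=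
    Nat.pos_of_ne_zero (Finset.prod_ne_zero_iff.mpr fun v _ => (Nat.ne_of_gt (hpos v)))
  have herase := Finset.add_sum_erase Finset.univ (fun v => G.degree v) (Finset.mem_univ v₀)
  rw [Finset.card_erase_of_mem (Finset.mem_univ v₀), Finset.card_univ] at hbound
  have hle : n + 1 ≤ ∏ v ∈ Finset.univ.erase v₀, G.degree v + G.degree v₀ := by
    omega
  nlinarith [Nat.mul_le_mul (hpos v₀) hprod]
end

section
/- Let G be a nonempty tree with n edges (n ≥ 1). Then the stringiness of G satisfies σ(G) ≤ 2^n. -/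
theorem two_mul_le_two_pow (d : ℕ) : 2 * d ≤ 2 ^ d := by
  cases d with
  | zero => simp
  | succ k =>
    rw [pow_succ, mul_comm]
    exact Nat.mul_le_mul_right 2 Nat.lt_two_pow_self

open Classical in
theorem stringiness_upper_bound {V : Type*} [Fintype V] (G : SimpleGraph V)
    (hG : G.IsTree) (n : ℕ) (hn : 1 ≤ n) (hedges : G.edgeFinset.card = n) :
    stringiness G ≤ 2 ^ n := by
  have hcard : Fintype.card V = n + 1 := by
    rw [← hG.card_edgeFinset, ← hedges]
  have hsum : ∑ v, G.degree v = 2 * n := by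
    rw [G.sum_degrees_eq_twice_card_edges, hedges]
  unfold stringiness
  split_ifs with h
  · generalize h.choose = v₀
    have hothers : (Finset.univ.erase v₀).card = n := by
      rw [Finset.card_erase_of_mem (Finset.mem_univ v₀), Finset.card_univ, hcard,
        Nat.add_sub_cancel]
    refine Nat.le_of_mul_le_mul_left ?_ (Nat.two_pow_pos n)
    calc 2 ^ n * ((G.degree v₀ + 1) * ∏ v ∈ Finset.univ.erase v₀, G.degree v)
        = (G.degree v₀ + 1) * ∏ v ∈ Finset.univ.erase v₀, 2 * G.degree v := by
          rw [Finset.prod_mul_distrib, Finset.prod_const, hothers]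
          ring
      _ ≤ 2 ^ G.degree v₀ * ∏ v ∈ Finset.univ.erase v₀, 2 ^ G.degree v := by
          gcongr
          · exact Nat.lt_two_pow_self
          · exact two_mul_le_two_pow _
      _ = 2 ^ n * 2 ^ n := by
          rw [Finset.mul_prod_erase _ (fun v ↦ 2 ^ G.degree v) (Finset.mem_univ v₀),
            Finset.prod_pow_eq_pow_sum, hsum, two_mul, pow_add]
  · exact Nat.one_le_two_pow
end

section
/- Let G be a finite tree that is not a star graph, and let w be a vertex of G such that deg_G(w) ≥ 2, all but one of the neighbors of w are leaves of G, and there exists a vertex v ≠ w with deg_G(v) ≥ deg_G(w). Let v_1, ..., v_y be the leaf neighbors of w (so y = deg_G(w) − 1), and let H = G − {v_1, ..., v_y} be the tree obtained by deleting these leaves. Then σ(G) = (y + 1)·σ(H). -/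
theorem stringiness_mul_degree {V : Type*} [Fintype V] (G : SimpleGraph V)
    [∀ v, Fintype (G.neighborSet v)] {m : V} (hm : ∀ v, G.degree v ≤ G.degree m) :
    stringiness G * G.degree m = (G.degree m + 1) * ∏ v, G.degree v := by
  classical
  have h : ∃ v0 : V, ∀ v, G.degree v ≤ G.degree v0 := ⟨m, hm⟩
  have hprod := Finset.mul_prod_erase Finset.univ (fun v => G.degree v)
    (Finset.mem_univ h.choose)
  have heq : G.degree m = G.degree h.choose := le_antisymm (h.choose_spec m) (hm _)
  have hstr : stringiness G =
      (G.degree h.choose + 1) * ∏ v ∈ Finset.univ.erase h.choose, G.degree v := by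
    rw [stringiness, dif_pos (by convert h)]
    congr!
  rw [hstr, heq, ← hprod]
  ring

open Classical in
theorem stringiness_delete_leaves {V : Type*} [Fintype V]
    (G : SimpleGraph V) (hG : G.IsTree)
    (hnotstar : ¬ ∃ c : V, ∀ v, v ≠ c → G.Adj c v)
    (w : V) (hw : 2 ≤ G.degree w)
    (honeleft : ∃! u : V, G.Adj w u ∧ G.degree u ≠ 1)
    (hbig : ∃ v : V, v ≠ w ∧ G.degree w ≤ G.degree v)
    (S : Finset V) (hS : S = (G.neighborFinset w).filter fun u => G.degree u = 1) :
    stringiness G = (S.card + 1) * stringiness (G.induce {v : V | v ∉ S}) := by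
  have mem_S : ∀ u, u ∈ S ↔ G.Adj w u ∧ G.degree u = 1 := by simp [hS]
  obtain ⟨m, hmw, hm⟩ : ∃ m, m ≠ w ∧ ∀ v, G.degree v ≤ G.degree m := by
    obtain ⟨m, -, hm⟩ := Finset.exists_max_image Finset.univ (fun v => G.degree v) ⟨w, by simp⟩
    obtain ⟨v, hv, hwv⟩ := hbig
    by_cases h : m = w
    · exact ⟨v, hv, fun u => (hm u (by simp)).trans (h ▸ hwv)⟩
    · exact ⟨m, h, fun u => hm u (by simp)⟩
  have hm2 : 2 ≤ G.degree m := hw.trans (hm w)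
  have hmS : m ∉ S := fun h => by have := ((mem_S m).1 h).2; omega
  have hwS : w ∉ S := fun h => by have := ((mem_S w).1 h).2; omega
  have hdegw : G.degree w = S.card + 1 := by
    obtain ⟨u, hu, huniq⟩ := honeleft
    have huS : u ∉ S := fun h => hu.2 ((mem_S u).1 h).2
    rw [← Finset.card_insert_of_notMem huS, ← SimpleGraph.card_neighborFinset_eq_degree]
    congr 1
    ext v
    rw [SimpleGraph.mem_neighborFinset, Finset.mem_insert, mem_S]
    constructor
    · intro h
      by_cases hv : G.degree v = 1
      · exact Or.inr ⟨h, hv⟩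
      · exact Or.inl (huniq v ⟨h, hv⟩)
    · rintro (rfl | h)
      exacts [hu.1, h.1]
  have hdeg : ∀ x : {v : V | v ∉ S}, (x : V) ≠ w →
      (G.induce {v : V | v ∉ S}).degree x = G.degree x := by
    intro x hx
    refine SimpleGraph.degree_induce_of_neighborSet_subset fun u hu hus => hx ?_
    obtain ⟨hwu, hu1⟩ := (mem_S u).1 hus
    exact (SimpleGraph.degree_eq_one_iff_existsUnique_adj.1 hu1).unique
      (SimpleGraph.Adj.symm hu) hwu.symm
  have hdegw' : (G.induce {v : V | v ∉ S}).degree ⟨w, hwS⟩ = 1 := by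
    rw [SimpleGraph.degree_eq_one_iff_existsUnique_adj]
    obtain ⟨u, hu, huniq⟩ := honeleft
    refine ⟨⟨u, fun h => hu.2 ((mem_S u).1 h).2⟩, hu.1, ?_⟩
    rintro ⟨v, hv⟩ hadj
    exact Subtype.ext (huniq v ⟨hadj, fun h => hv ((mem_S v).2 ⟨hadj, h⟩)⟩)
  have hmdeg := hdeg ⟨m, hmS⟩ hmw
  have hmH : ∀ x, (G.induce {v : V | v ∉ S}).degree x ≤
      (G.induce {v : V | v ∉ S}).degree ⟨m, hmS⟩ := by
    intro x
    rw [hmdeg]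
    by_cases hx : (x : V) = w
    · obtain rfl : x = ⟨w, hwS⟩ := Subtype.ext hx
      rw [hdegw']
      exact le_trans (by norm_num) hm2
    · rw [hdeg x hx]
      exact hm x
  have hprod : ∏ v, G.degree v =
      (S.card + 1) * ∏ x, (G.induce {v : V | v ∉ S}).degree x := by
    have hsub : ∏ v, G.degree v = ∏ x : {v : V | v ∉ S}, G.degree x := by
      rw [← Finset.prod_subset (Finset.subset_univ Sᶜ)
        fun v _ hv => ((mem_S v).1 (by simpa using hv)).2]
      exact Finset.prod_subtype _ (by simp) _
    rw [hsub, ← Finset.mul_prod_erase _ _ (Finset.mem_univ ⟨w, hwS⟩),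
      ← Finset.mul_prod_erase _ (fun x => (G.induce {v : V | v ∉ S}).degree x)
        (Finset.mem_univ ⟨w, hwS⟩), hdegw', hdegw, one_mul]
    congr 1
    refine Finset.prod_congr rfl fun x hx => (hdeg x fun h => ?_).symm
    exact (Finset.mem_erase.1 hx).1 (Subtype.ext h)
  have hH := stringiness_mul_degree (G.induce {v : V | v ∉ S}) hmH
  rw [hmdeg] at hH
  refine Nat.eq_of_mul_eq_mul_right (show 0 < G.degree m by omega) ?_
  rw [stringiness_mul_degree G hm, hprod, mul_assoc, hH, mul_left_comm]
end

section
/- Let G be a tree with at least 2 edges and let v be a leaf of G. Then deleting v strictly decreases the stringiness: σ(G − v) < σ(G). -/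
open Classical in
theorem exists_stringiness_eq {V : Type*} [Fintype V] [Nonempty V] (G : SimpleGraph V) :
    ∃ m : V, (∀ x, G.degree x ≤ G.degree m) ∧
      stringiness G = (G.degree m + 1) * ∏ x ∈ Finset.univ.erase m, G.degree x := by
  have h : ∃ m : V, ∀ x, G.degree x ≤ G.degree m := Finite.exists_max fun x => G.degree x
  exact ⟨h.choose, h.choose_spec, dif_pos h⟩

open Classical in
/-- Among the ways to add one to a single factor of the product of the degrees, adding it
to the largest one gives the least product. -/
theorem stringiness_le {V : Type*} [Fintype V] (G : SimpleGraph V) (y : V) :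
    stringiness G ≤ (G.degree y + 1) * ∏ x ∈ Finset.univ.erase y, G.degree x := by
  have : Nonempty V := ⟨y⟩
  obtain ⟨m, hm, h⟩ := exists_stringiness_eq G
  rw [h, add_one_mul, add_one_mul, Finset.mul_prod_erase _ (fun x => G.degree x) (Finset.mem_univ m),
    Finset.mul_prod_erase _ (fun x => G.degree x) (Finset.mem_univ y)]
  refine Nat.add_le_add_left ?_ _
  obtain rfl | hne := eq_or_ne m y
  · exact le_rfl
  rw [← Finset.mul_prod_erase (Finset.univ.erase m) (fun x => G.degree x) (a := y) (by simp [hne.symm]),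
    ← Finset.mul_prod_erase (Finset.univ.erase y) (fun x => G.degree x) (a := m) (by simp [hne]),
    Finset.erase_right_comm]
  exact Nat.mul_le_mul_right _ (hm y)

open Classical in
theorem add_one_mul_prod_erase {V : Type*} [Fintype V] (f : V → ℕ) (m : V) :
    (f m + 1) * ∏ x ∈ Finset.univ.erase m, f x = ∏ x, (f x + if x = m then 1 else 0) := by
  rw [← Finset.mul_prod_erase _ _ (Finset.mem_univ m), if_pos rfl]
  congr 1
  exact Finset.prod_congr rfl fun x hx => by simp [Finset.ne_of_mem_erase hx]

theorem degree_induce_le {V : Type*} (G : SimpleGraph V) (s : Set V) (x : s)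
    [Fintype (G.neighborSet x)] [Fintype ((G.induce s).neighborSet x)] :
    (G.induce s).degree x ≤ G.degree x := by
  rw [← SimpleGraph.card_neighborFinset_eq_degree, ← SimpleGraph.card_neighborFinset_eq_degree,
    ← Finset.card_map (Function.Embedding.subtype (· ∈ s))]
  refine Finset.card_le_card fun y => ?_
  simp +contextual

theorem degree_induce_lt {V : Type*} (G : SimpleGraph V) (s : Set V) (x : s)
    [Fintype (G.neighborSet x)] [Fintype ((G.induce s).neighborSet x)]
    {v : V} (hv : v ∉ s) (h : G.Adj x v) : (G.induce s).degree x < G.degree x := by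
  rw [← SimpleGraph.card_neighborFinset_eq_degree, ← SimpleGraph.card_neighborFinset_eq_degree,
    ← Finset.card_map (Function.Embedding.subtype (· ∈ s))]
  refine Finset.card_lt_card ((Finset.ssubset_iff_of_subset ?_).2 ⟨v, by simpa using h, ?_⟩)
  · intro y
    simp +contextual
  · simp [hv]

open Classical in
theorem stringiness_delete_leaf_lt {V : Type*} [Fintype V]
    (G : SimpleGraph V) (hG : G.IsTree)
    (hedges : 2 ≤ G.edgeFinset.card)
    (v : V) (hv : G.degree v = 1) :
    stringiness (G.induce {u : V | u ≠ v}) < stringiness G := by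
  have : Nonempty V := ⟨v⟩
  have : Nontrivial {u : V | u ≠ v} := by
    have hcard := hG.card_edgeFinset
    rw [← Fintype.one_lt_card_iff_nontrivial, Fintype.card_subtype]
    simp only [Set.mem_ofPred_eq, Finset.filter_ne', Finset.card_erase_of_mem (Finset.mem_univ v),
      Finset.card_univ]
    omega
  have hconn : (G.induce {u : V | u ≠ v}).Connected :=
    hG.connected.induce_compl_singleton_of_degree_eq_one hv
  obtain ⟨w, hw⟩ : ∃ w, G.Adj v w := (G.degree_pos_iff_exists_adj v).1 (by omega)
  -- Naming the induced graph keeps its own decidability instance out of the degrees below.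
  generalize hH : G.induce {u : V | u ≠ v} = H at hconn ⊢
  have hpos (x) : 0 < H.degree x := hconn.preconnected.degree_pos_of_nontrivial x
  have hle (x) : H.degree x ≤ G.degree x := by
    subst hH
    exact degree_induce_le G _ x
  have hlt : H.degree ⟨w, hw.ne'⟩ < G.degree w := by
    subst hH
    exact degree_induce_lt G {u | u ≠ v} ⟨w, hw.ne'⟩ (by simp) hw.symm
  obtain ⟨m, hm, hσ⟩ := exists_stringiness_eq G
  have hmv : m ≠ v := by
    rintro rfl
    have := hm w
    have := hpos ⟨w, hw.ne'⟩
    omega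
  refine (stringiness_le H ⟨m, hmv⟩).trans_lt ?_
  rw [hσ, add_one_mul_prod_erase (fun x => H.degree x),
    add_one_mul_prod_erase (fun x => G.degree x),
    ← Finset.mul_prod_erase _ _ (Finset.mem_univ v), hv, if_neg hmv.symm, add_zero, one_mul,
    Finset.prod_subtype (p := (· ∈ {u : V | u ≠ v})) (Finset.univ.erase v) (by simp)]
  refine Finset.prod_lt_prod (fun x _ => Nat.add_pos_left (hpos x) _) (fun x _ => ?_)
    ⟨⟨w, hw.ne'⟩, Finset.mem_univ _, ?_⟩
  · simpa [Subtype.ext_iff] using hle x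
  · simpa [Subtype.ext_iff] using hlt
end
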